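/- Let μ be a symmetric vector valued form of degree 1 on a ℤ-graded vector space E with [μ,μ]_RN = 0 (a (curved) L∞-structure), and let 𝒩 be a Nijenhuis symmetric vector valued form with respect to μ with square 𝒦. For each integer k ≥ 1 set μ_k = [𝒩,[𝒩,…,[𝒩,μ]_RN…]_RN]_RN (k copies of 𝒩). Then: (1) for every k ≥ 1, [μ_k,μ_k]_RN = 0 (so μ_k is a (curved) L∞-structure) and 𝒩 is Nijenhuis with respect to μ_k with the same square 𝒦; (2) [μ_k,μ_l]_RN = 0 for all integers k, l ≥ 1. -/

import Mathlib

open scoped DirectSum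
open Classical

noncomputable section

namespace RN

section Core

variable (𝕜 : Type) [Field 𝕜] [CharZero 𝕜]
variable (E : ℤ → Type) [∀ i, AddCommGroup (E i)] [∀ i, Module 𝕜 (E i)]

/-- Raw vector-valued forms on the graded vector space `E`: for every arity `n` and every
vector of (input) degrees `ι`, a function on homogeneous tuples with values in the total
graded space `⨁ i, E i`. -/
abbrev RawForm : Type :=
  ∀ n : ℕ, ∀ ι : Fin n → ℤ, (∀ j, E (ι j)) → ⨁ i, E i

/-- Multilinearity (in each slot, on homogeneous arguments). -/
def IsMultilin (F : RawForm E) : Prop :=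
  ∀ (n : ℕ) (ι : Fin n → ℤ) (x : ∀ j, E (ι j)) (j : Fin n) (a b : E (ι j)) (c : 𝕜),
    F n ι (Function.update x j (a + b)) =
        F n ι (Function.update x j a) + F n ι (Function.update x j b) ∧
      F n ι (Function.update x j (c • a)) = c • F n ι (Function.update x j a)

/-- Graded symmetry: swapping two adjacent homogeneous arguments multiplies the value
by the Koszul sign `(-1)^{|X||Y|}`. -/
def IsGradedSym (F : RawForm E) : Prop :=
  ∀ (n : ℕ) (ι : Fin n → ℤ) (x : ∀ j, E (ι j)) (p q : Fin n), (p : ℕ) + 1 = (q : ℕ) →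
    F n (fun j => ι (Equiv.swap p q j)) (fun j => x (Equiv.swap p q j)) =
      ((-1 : 𝕜) ^ (ι p * ι q)) • F n ι x

/-- `F` has degree `d`: its value on homogeneous arguments of degrees `ι` is homogeneous
of degree `(∑ j, ι j) + d`. -/
def IsOfDeg (d : ℤ) (F : RawForm E) : Prop :=
  ∀ (n : ℕ) (ι : Fin n → ℤ) (x : ∀ j, E (ι j)) (m : ℤ),
    m ≠ (∑ j, ι j) + d → F n ι x m = 0

/-- Symmetric vector valued form of degree `d`. -/
def IsSVF (d : ℤ) (F : RawForm E) : Prop :=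
  IsMultilin 𝕜 E F ∧ IsGradedSym 𝕜 E F ∧ IsOfDeg E d F

/-- `F` is (concentrated in) a `k`-form. -/
def IsArity (k : ℕ) (F : RawForm E) : Prop :=
  ∀ n, n ≠ k → ∀ (ι : Fin n → ℤ) (x : ∀ j, E (ι j)), F n ι x = 0

/-- `F` has no 0-form (curvature) component. -/
def NoCurv (F : RawForm E) : Prop :=
  ∀ (ι : Fin 0 → ℤ) (x : ∀ j, E (ι j)), F 0 ι x = 0

/-- `(k, n-k)`-shuffles of `Fin n`. -/
def IsShuffle (k : ℕ) {n : ℕ} (σ : Equiv.Perm (Fin n)) : Prop :=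
  ∀ i j : Fin n, i < j → ((j : ℕ) < k ∨ k ≤ (i : ℕ)) → σ i < σ j

/-- The Koszul sign of the rearrangement `(X_{σ(1)},…,X_{σ(n)})` of homogeneous elements
of degrees `ι`. -/
def koszulSign {n : ℕ} (ι : Fin n → ℤ) (σ : Equiv.Perm (Fin n)) : 𝕜 :=
  ∏ p ∈ Finset.univ.filter (fun p : Fin n × Fin n => p.1 < p.2 ∧ σ p.2 < σ p.1),
    (-1 : 𝕜) ^ (ι (σ p.1) * ι (σ p.2))

/-- Prepend a degree to a vector of degrees. -/
def dcons {n : ℕ} (m : ℤ) (rest : Fin n → ℤ) : Fin (n + 1) → ℤ :=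
  fun j => if h : (j : ℕ) = 0 then m else rest ⟨(j : ℕ) - 1, by have := j.isLt; omega⟩

/-- Prepend a homogeneous element to a tuple of homogeneous elements. -/
def dconsV {n : ℕ} {m : ℤ} {rest : Fin n → ℤ} (v : E m) (xs : ∀ i, E (rest i)) :
    ∀ j : Fin (n + 1), E (dcons m rest j) := fun j => by
  unfold dcons
  by_cases h : (j : ℕ) = 0
  · rw [dif_pos h]; exact v
  · rw [dif_neg h]; exact xs ⟨(j : ℕ) - 1, by have := j.isLt; omega⟩

/-- The insertion operator `ι_F G`, summing over shuffles with Koszul signs. -/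
def ins (F G : RawForm E) : RawForm E :=
  fun n ι x =>
    ∑ k : Fin (n + 1),
      ∑ σ ∈ Finset.univ.filter (fun σ : Equiv.Perm (Fin n) => IsShuffle (k : ℕ) σ),
        koszulSign 𝕜 ι σ •
          DFinsupp.sum
            (F (k : ℕ)
              (fun i => ι (σ ⟨(i : ℕ), by have h1 := i.isLt; have h2 := k.isLt; omega⟩))
              (fun i => x (σ ⟨(i : ℕ), by have h1 := i.isLt; have h2 := k.isLt; omega⟩)))
            (fun m v =>
              G (n - (k : ℕ) + 1)
                (dcons m
                  (fun i => ι (σ ⟨(k : ℕ) + (i : ℕ), by have h1 := i.isLt; have h2 := k.isLt; omega⟩)))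
                (dconsV E v
                  (fun i => x (σ ⟨(k : ℕ) + (i : ℕ), by have h1 := i.isLt; have h2 := k.isLt; omega⟩))))

/-- The Richardson–Nijenhuis bracket `[F,G]_RN = ι_F G - (-1)^{dK·dL} ι_G F` of forms
of degrees `dK` and `dL`. -/
def rnb (dK dL : ℤ) (F G : RawForm E) : RawForm E :=
  fun n ι x => ins 𝕜 E F G n ι x - ((-1 : 𝕜) ^ (dK * dL)) • ins 𝕜 E G F n ι x

/-- An element of the graded vector space, regarded as a vector valued 0-form. -/
def ofElem (v : ⨁ i, E i) : RawForm E := fun n _ _ => if n = 0 then v else 0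

/-- The Euler map `S(X) = -|X|·X`, a vector valued 1-form of degree 0. -/
def euler : RawForm E :=
  fun n ι x =>
    if h : n = 1 then
      (-(ι ⟨0, by omega⟩)) • DirectSum.of E (ι ⟨0, by omega⟩) (x ⟨0, by omega⟩)
    else 0

/-- The identity map of `E`, regarded as a vector valued 1-form of degree 0. -/
def idF : RawForm E :=
  fun n ι x =>
    if h : n = 1 then DirectSum.of E (ι ⟨0, by omega⟩) (x ⟨0, by omega⟩) else 0

/-- The arity-`k` component of a vector valued form. -/
def comp (F : RawForm E) (k : ℕ) : RawForm E :=
  fun n ι x => if n = k then F n ι x else 0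

end Core

/-- The iterated deformation `μ_k = [𝒩,[𝒩,…,[𝒩,μ]_RN…]_RN]_RN` (`k` copies of `𝒩`,
with `𝒩` of degree 0 and `μ` of degree 1). -/
def deform (𝕜 : Type) [Field 𝕜] [CharZero 𝕜] (E : ℤ → Type) [∀ i, AddCommGroup (E i)]
    [∀ i, Module 𝕜 (E i)] (N μ : RawForm E) : ℕ → RawForm E
  | 0 => μ
  | k + 1 => rnb 𝕜 E 0 1 N (deform 𝕜 E N μ k)

section Words

variable (𝕜 : Type) [Field 𝕜]
variable {E : ℤ → Type}
variable {V W : Type} [AddCommGroup V] [Module 𝕜 V] [AddCommGroup W] [Module 𝕜 W]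

/-- Words in homogeneous elements of `E`. -/
abbrev Word (E : ℤ → Type) : Type := List (Σ i, E i)

/-- The total degree of a word. -/
def wdeg : Word E → ℤ
  | [] => 0
  | x :: w => x.1 + wdeg w

@[simp] lemma wdeg_nil : wdeg ([] : Word E) = 0 := rfl

@[simp] lemma wdeg_cons (x : Σ i, E i) (w : Word E) : wdeg (x :: w) = x.1 + wdeg w := rfl

@[simp] lemma wdeg_append (u v : Word E) : wdeg (u ++ v) = wdeg u + wdeg v := by
  induction u with
  | nil => simp
  | cons x u ih => simp [ih, add_assoc]

lemma sign_add (a b : ℤ) : (-1 : 𝕜) ^ (a + b) = (-1) ^ a * (-1) ^ b :=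
  zpow_add₀ (by simp) a b

lemma sign_mul_self (a : ℤ) : (-1 : 𝕜) ^ a * (-1) ^ a = 1 := by
  rw [← mul_zpow]; simp

/-- The sum of `Φ u v` with Koszul signs over all unshuffles `(u, v)` of a word. -/
def usum : Word E → (Word E → Word E → V) → V
  | [], Φ => Φ [] []
  | x :: w, Φ => usum w fun u v => Φ (x :: u) v + (-1 : 𝕜) ^ (x.1 * wdeg u) • Φ u (x :: v)

@[simp] lemma usum_nil (Φ : Word E → Word E → V) : usum 𝕜 [] Φ = Φ [] [] := rfl

lemma usum_cons (x : Σ i, E i) (w : Word E) (Φ : Word E → Word E → V) :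
    usum 𝕜 (x :: w) Φ =
      usum 𝕜 w fun u v => Φ (x :: u) v + (-1 : 𝕜) ^ (x.1 * wdeg u) • Φ u (x :: v) := rfl

lemma usum_congr {w : Word E} {Φ Ψ : Word E → Word E → V}
    (h : ∀ u v, wdeg u + wdeg v = wdeg w → Φ u v = Ψ u v) : usum 𝕜 w Φ = usum 𝕜 w Ψ := by
  induction w generalizing Φ Ψ with
  | nil => exact h _ _ (by simp)
  | cons x w ih =>
    refine ih fun u v huv => ?_
    rw [h (x :: u) v (by simp; omega), h u (x :: v) (by simp; omega)]

lemma usum_add (w : Word E) (Φ Ψ : Word E → Word E → V) :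
    usum 𝕜 w (fun u v => Φ u v + Ψ u v) = usum 𝕜 w Φ + usum 𝕜 w Ψ := by
  induction w generalizing Φ Ψ with
  | nil => rfl
  | cons x w ih =>
    simp only [usum_cons, ← ih]
    congr 1; funext u v
    rw [smul_add]; abel

lemma map_usum (L : V →ₗ[𝕜] W) (w : Word E) (Φ : Word E → Word E → V) :
    L (usum 𝕜 w Φ) = usum 𝕜 w fun u v => L (Φ u v) := by
  induction w generalizing Φ with
  | nil => rfl
  | cons x w ih => simp only [usum_cons, ih, map_add, map_smul]

lemma usum_smul (c : 𝕜) (w : Word E) (Φ : Word E → Word E → V) :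
    usum 𝕜 w (fun u v => c • Φ u v) = c • usum 𝕜 w Φ :=
  (map_usum 𝕜 (LinearMap.lsmul 𝕜 V c) w Φ).symm

lemma usum_zero (w : Word E) : usum 𝕜 w (fun _ _ => (0 : V)) = 0 :=
  (map_usum 𝕜 (0 : V →ₗ[𝕜] V) w fun _ _ => 0).symm

lemma usum_coassoc (w : Word E) (Φ : Word E → Word E → Word E → V) :
    usum 𝕜 w (fun p v₂ => usum 𝕜 p fun u v₁ => Φ u v₁ v₂) =
      usum 𝕜 w fun u q => usum 𝕜 q fun v₁ v₂ => Φ u v₁ v₂ := by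
  induction w generalizing Φ with
  | nil => rfl
  | cons x w ih =>
    simp only [usum_cons, ← usum_smul, ← usum_add]
    rw [← ih]
    refine usum_congr 𝕜 fun p v₂ _ => usum_congr 𝕜 fun u v₁ h => ?_
    rw [← h, mul_add, sign_add, smul_add, smul_smul, add_assoc]

lemma usum_cocomm (w : Word E) (Φ : Word E → Word E → V) :
    usum 𝕜 w Φ = usum 𝕜 w fun u v => (-1 : 𝕜) ^ (wdeg u * wdeg v) • Φ v u := by
  induction w generalizing Φ with
  | nil => simp
  | cons x w ih =>
    rw [usum_cons, ih, usum_cons]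
    refine usum_congr 𝕜 fun u v _ => ?_
    simp only [wdeg_cons, mul_add, add_mul, sign_add, smul_add, smul_smul]
    rw [add_comm, mul_comm (wdeg u) x.1, mul_left_comm, ← mul_assoc,
      sign_mul_self, one_mul]
    congr 2
    exact mul_comm _ _

/-- Graded symmetry of a function on words. -/
def SymOn (f : Word E → V) : Prop :=
  ∀ (p q : Word E) (x y : Σ i, E i),
    f (p ++ x :: y :: q) = (-1 : 𝕜) ^ (x.1 * y.1) • f (p ++ y :: x :: q)

variable {𝕜}

namespace SymOn

lemma comp_cons {f : Word E → V} (hf : SymOn 𝕜 f) (x : Σ i, E i) :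
    SymOn 𝕜 fun w => f (x :: w) :=
  fun p => hf (x :: p)

lemma add {f g : Word E → V} (hf : SymOn 𝕜 f) (hg : SymOn 𝕜 g) :
    SymOn 𝕜 fun w => f w + g w := fun p q x y => by
  beta_reduce; rw [hf, hg, smul_add]

lemma sign_smul {f : Word E → V} (hf : SymOn 𝕜 f) (s : ℤ → 𝕜) :
    SymOn 𝕜 fun w => s (wdeg w) • f w := fun p q x y => by
  beta_reduce
  rw [hf, smul_comm]
  simp only [wdeg_append, wdeg_cons, add_left_comm]

lemma linearMap_comp {f : Word E → V} (hf : SymOn 𝕜 f) (L : V →ₗ[𝕜] W) :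
    SymOn 𝕜 fun w => L (f w) := fun p q x y => by
  beta_reduce; rw [hf, map_smul]

lemma usum {Φ : Word E → Word E → V} (h₁ : ∀ v, SymOn 𝕜 fun u => Φ u v)
    (h₂ : ∀ u, SymOn 𝕜 (Φ u)) : SymOn 𝕜 fun w => usum 𝕜 w Φ := by
  intro p
  induction p generalizing Φ with
  | nil =>
    intro q x y
    simp only [List.nil_append, usum_cons]
    rw [← usum_smul]
    refine usum_congr 𝕜 fun u v _ => ?_
    have e₁ := h₁ v [] u x y
    have e₂ := h₂ u [] v x y
    simp only [List.nil_append] at e₁ e₂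
    rw [e₁, e₂]
    simp only [wdeg_cons, mul_add, sign_add, smul_add, smul_smul, mul_comm y.1 x.1]
    simp only [← mul_assoc, sign_mul_self, one_mul]
    module
  | cons x p ih =>
    simp only [List.cons_append, usum_cons]
    exact ih
      (fun v => ((h₁ v).comp_cons x).add ((h₁ _).sign_smul fun d => (-1) ^ (x.1 * d)))
      (fun u => (h₂ _).add (((h₂ u).comp_cons x).sign_smul fun _ => (-1) ^ (x.1 * wdeg u)))

end SymOn

variable [∀ i, AddCommGroup (E i)] [∀ i, Module 𝕜 (E i)]

variable (𝕜) in
/-- Multilinearity of a function on words. -/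
structure MultilinOn (f : Word E → V) : Prop where
  map_add : ∀ (p q : Word E) (i : ℤ) (a b : E i),
    f (p ++ ⟨i, a + b⟩ :: q) = f (p ++ ⟨i, a⟩ :: q) + f (p ++ ⟨i, b⟩ :: q)
  map_smul : ∀ (p q : Word E) (i : ℤ) (c : 𝕜) (a : E i),
    f (p ++ ⟨i, c • a⟩ :: q) = c • f (p ++ ⟨i, a⟩ :: q)

namespace MultilinOn

lemma comp_cons {f : Word E → V} (hf : MultilinOn 𝕜 f) (x : Σ i, E i) :
    MultilinOn 𝕜 fun w => f (x :: w) :=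
  ⟨fun p => hf.map_add (x :: p), fun p => hf.map_smul (x :: p)⟩

lemma add {f g : Word E → V} (hf : MultilinOn 𝕜 f) (hg : MultilinOn 𝕜 g) :
    MultilinOn 𝕜 fun w => f w + g w :=
  ⟨fun p q i a b => by simp only [hf.map_add, hg.map_add]; abel,
    fun p q i c a => by simp only [hf.map_smul, hg.map_smul, smul_add]⟩

lemma sign_smul {f : Word E → V} (hf : MultilinOn 𝕜 f) (s : ℤ → 𝕜) :
    MultilinOn 𝕜 fun w => s (wdeg w) • f w :=
  ⟨fun p q i a b => by simp only [hf.map_add, wdeg_append, wdeg_cons, smul_add],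
    fun p q i c a => by
      simp only [hf.map_smul, wdeg_append, wdeg_cons]; rw [smul_comm]⟩

lemma linearMap_comp {f : Word E → V} (hf : MultilinOn 𝕜 f) (L : V →ₗ[𝕜] W) :
    MultilinOn 𝕜 fun w => L (f w) :=
  ⟨fun p q i a b => by simp only [hf.map_add, _root_.map_add],
    fun p q i c a => by simp only [hf.map_smul, _root_.map_smul]⟩

lemma usum {Φ : Word E → Word E → V} (h₁ : ∀ v, MultilinOn 𝕜 fun u => Φ u v)
    (h₂ : ∀ u, MultilinOn 𝕜 (Φ u)) : MultilinOn 𝕜 fun w => usum 𝕜 w Φ := by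
  have key : ∀ (p : Word E) (Φ : Word E → Word E → V) (_ : ∀ v, MultilinOn 𝕜 fun u => Φ u v)
      (_ : ∀ u, MultilinOn 𝕜 (Φ u)) (q : Word E) (i : ℤ),
      (∀ a b : E i, RN.usum 𝕜 (p ++ ⟨i, a + b⟩ :: q) Φ =
        RN.usum 𝕜 (p ++ ⟨i, a⟩ :: q) Φ + RN.usum 𝕜 (p ++ ⟨i, b⟩ :: q) Φ) ∧
      ∀ (c : 𝕜) (a : E i), RN.usum 𝕜 (p ++ ⟨i, c • a⟩ :: q) Φ =
        c • RN.usum 𝕜 (p ++ ⟨i, a⟩ :: q) Φ := by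
    intro p
    induction p with
    | nil =>
      intro Φ h₁ h₂ q i
      simp only [List.nil_append, usum_cons]
      constructor
      · intro a b
        rw [← usum_add]
        refine usum_congr 𝕜 fun u v _ => ?_
        have e₁ := (h₁ v).map_add [] u i a b
        have e₂ := (h₂ u).map_add [] v i a b
        simp only [List.nil_append] at e₁ e₂
        rw [e₁, e₂, smul_add]; abel
      · intro c a
        rw [← usum_smul]
        refine usum_congr 𝕜 fun u v _ => ?_
        have e₁ := (h₁ v).map_smul [] u i c a
        have e₂ := (h₂ u).map_smul [] v i c a
        simp only [List.nil_append] at e₁ e₂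
        rw [e₁, e₂, smul_add, smul_comm c]
    | cons x p ih =>
      intro Φ h₁ h₂ q i
      simp only [List.cons_append, usum_cons]
      exact ih _
        (fun v => ((h₁ v).comp_cons x).add ((h₁ _).sign_smul fun d => (-1) ^ (x.1 * d)))
        (fun u => (h₂ _).add (((h₂ u).comp_cons x).sign_smul fun _ => (-1) ^ (x.1 * wdeg u)))
        q i
  exact ⟨fun p q i => (key p Φ h₁ h₂ q i).1, fun p q i => (key p Φ h₁ h₂ q i).2⟩

end MultilinOn

end Words

section Insertion

variable {𝕜 : Type} [Field 𝕜]
variable {E : ℤ → Type} [∀ i, AddCommGroup (E i)] [∀ i, Module 𝕜 (E i)]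

/-- The extension of `w ↦ g w` to words whose first letter is an element of `⨁ i, E i`. -/
def extend (g : Word E → ⨁ i, E i) (m : ⨁ i, E i) (v : Word E) : ⨁ i, E i :=
  DFinsupp.sum m fun i e => g (⟨i, e⟩ :: v)

/-- `extend`, as a linear map in the first letter. -/
def MultilinOn.extendLin {g : Word E → ⨁ i, E i} (hg : MultilinOn 𝕜 g) (v : Word E) :
    (⨁ i, E i) →ₗ[𝕜] ⨁ i, E i :=
  DirectSum.toModule 𝕜 ℤ _ fun i =>
    { toFun := fun e => g (⟨i, e⟩ :: v)
      map_add' := hg.map_add [] v i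
      map_smul' := hg.map_smul [] v i }

lemma MultilinOn.extendLin_apply {g : Word E → ⨁ i, E i} (hg : MultilinOn 𝕜 g) (v : Word E)
    (m : ⨁ i, E i) : hg.extendLin v m = extend g m v :=
  DFinsupp.sumAddHom_apply _ _

lemma MultilinOn.extend_of {g : Word E → ⨁ i, E i} (hg : MultilinOn 𝕜 g) (v : Word E)
    (i : ℤ) (e : E i) : extend g (DirectSum.of E i e) v = g (⟨i, e⟩ :: v) := by
  rw [← hg.extendLin_apply]
  exact DirectSum.toModule_lof 𝕜 i e

lemma MultilinOn.extend_right {g : Word E → ⨁ i, E i} (hg : MultilinOn 𝕜 g) (m : ⨁ i, E i) :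
    MultilinOn 𝕜 (extend g m) :=
  ⟨fun p q i a b => by
    simp only [extend, DFinsupp.sum, ← Finset.sum_add_distrib]
    exact Finset.sum_congr rfl fun j _ => hg.map_add (⟨j, m j⟩ :: p) q i a b,
  fun p q i c a => by
    simp only [extend, DFinsupp.sum, Finset.smul_sum]
    exact Finset.sum_congr rfl fun j _ => hg.map_smul (⟨j, m j⟩ :: p) q i c a⟩

lemma SymOn.extend_right {g : Word E → ⨁ i, E i} (hg : SymOn 𝕜 g) (m : ⨁ i, E i) :
    SymOn 𝕜 (extend g m) := fun p q x y => by
  simp only [extend, DFinsupp.sum, Finset.smul_sum]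
  exact Finset.sum_congr rfl fun j _ => hg (⟨j, m j⟩ :: p) q x y

/-- Homogeneity of degree `d` of a function on words. -/
def HomogOn (d : ℤ) (f : Word E → ⨁ i, E i) : Prop :=
  ∀ w m, m ≠ wdeg w + d → f w m = 0

/-- The value on a word of a function homogeneous of degree `d`, as a letter. -/
def letter (d : ℤ) (f : Word E → ⨁ i, E i) (w : Word E) : Σ i, E i :=
  ⟨wdeg w + d, f w (wdeg w + d)⟩

lemma HomogOn.eq_of {d : ℤ} {f : Word E → ⨁ i, E i} (hf : HomogOn d f) (w : Word E) :
    f w = DirectSum.of E (wdeg w + d) (f w (wdeg w + d)) := by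
  refine DFinsupp.ext fun m => ?_
  by_cases h : m = wdeg w + d
  · subst h; exact (DirectSum.of_eq_same _ _).symm
  · exact (hf w m h).trans (DirectSum.of_eq_of_ne _ _ _ h).symm

lemma extend_homog {d : ℤ} {f g : Word E → ⨁ i, E i} (hf : HomogOn d f)
    (hg : MultilinOn 𝕜 g) (u v : Word E) : extend g (f u) v = g (letter d f u :: v) := by
  rw [hf.eq_of u, hg.extend_of]; rfl

variable (𝕜) in
/-- Insertion of functions on words. -/
def insW (f g : Word E → ⨁ i, E i) : Word E → ⨁ i, E i := fun w =>
  usum 𝕜 w fun u v => extend g (f u) v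

variable (𝕜) in
/-- Symmetric vector valued forms of degree `d`, as functions on words. -/
structure SVFOn (d : ℤ) (f : Word E → ⨁ i, E i) : Prop where
  multilin : MultilinOn 𝕜 f
  sym : SymOn 𝕜 f
  homog : HomogOn d f

lemma SVFOn.add {d : ℤ} {f g : Word E → ⨁ i, E i} (hf : SVFOn 𝕜 d f) (hg : SVFOn 𝕜 d g) :
    SVFOn 𝕜 d (f + g) :=
  ⟨hf.multilin.add hg.multilin, hf.sym.add hg.sym, fun w m h => by
    rw [Pi.add_apply, DirectSum.add_apply, hf.homog w m h, hg.homog w m h, add_zero]⟩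

lemma SVFOn.smul {d : ℤ} {f : Word E → ⨁ i, E i} (hf : SVFOn 𝕜 d f) (c : 𝕜) :
    SVFOn 𝕜 d (c • f) :=
  ⟨hf.multilin.sign_smul fun _ => c, hf.sym.sign_smul fun _ => c, fun w m h => by
    rw [Pi.smul_apply, DirectSum.smul_apply, hf.homog w m h, smul_zero]⟩

lemma SVFOn.ins {d e : ℤ} {f g : Word E → ⨁ i, E i} (hf : SVFOn 𝕜 d f) (hg : SVFOn 𝕜 e g) :
    SVFOn 𝕜 (d + e) (insW 𝕜 f g) where
  multilin := MultilinOn.usum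
    (fun v => by
      simpa only [hg.multilin.extendLin_apply] using
        hf.multilin.linearMap_comp (hg.multilin.extendLin v))
    (fun u => hg.multilin.extend_right (f u))
  sym := SymOn.usum
    (fun v => by
      simpa only [hg.multilin.extendLin_apply] using
        hf.sym.linearMap_comp (hg.multilin.extendLin v))
    (fun u => hg.sym.extend_right (f u))
  homog w m h := by
    have := map_usum 𝕜 (DirectSum.component 𝕜 ℤ E m) w fun u v => extend g (f u) v
    refine this.trans ((usum_congr 𝕜 fun u v huv => ?_).trans (usum_zero 𝕜 w))
    rw [extend_homog hf.homog hg.multilin]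
    refine hg.homog _ m fun hm => h ?_
    rw [hm, ← huv, wdeg_cons, letter]; ring

lemma insW_add_left {f f' g : Word E → ⨁ i, E i} (hg : MultilinOn 𝕜 g) :
    insW 𝕜 (f + f') g = insW 𝕜 f g + insW 𝕜 f' g := by
  funext w
  simp only [insW, Pi.add_apply, ← hg.extendLin_apply, map_add, usum_add]

lemma insW_smul_left {f g : Word E → ⨁ i, E i} (hg : MultilinOn 𝕜 g) (c : 𝕜) :
    insW 𝕜 (c • f) g = c • insW 𝕜 f g := by
  funext w
  simp only [insW, Pi.smul_apply, ← hg.extendLin_apply, map_smul, usum_smul]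

lemma insW_add_right (f g g' : Word E → ⨁ i, E i) :
    insW 𝕜 f (g + g') = insW 𝕜 f g + insW 𝕜 f g' := by
  funext w
  simp only [insW, Pi.add_apply, extend, DFinsupp.sum, Finset.sum_add_distrib, usum_add]

lemma insW_smul_right (f g : Word E → ⨁ i, E i) (c : 𝕜) :
    insW 𝕜 f (c • g) = c • insW 𝕜 f g := by
  funext w
  simp only [insW, Pi.smul_apply, extend, DFinsupp.sum, ← Finset.smul_sum, usum_smul]

variable (𝕜) in
/-- The simultaneous insertion of `f` and `g` into the first two arguments of `h`. -/
def insTwo (d e : ℤ) (f g h : Word E → ⨁ i, E i) : Word E → ⨁ i, E i := fun w =>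
  usum 𝕜 w fun u q => usum 𝕜 q fun v₁ v₂ =>
    (-1 : 𝕜) ^ ((wdeg u + d) * wdeg v₁) • h (letter e g v₁ :: letter d f u :: v₂)

lemma insW_insW {d e k : ℤ} {f g h : Word E → ⨁ i, E i} (hf : SVFOn 𝕜 d f)
    (hg : SVFOn 𝕜 e g) (hh : SVFOn 𝕜 k h) :
    insW 𝕜 f (insW 𝕜 g h) = insW 𝕜 (insW 𝕜 f g) h + insTwo 𝕜 d e f g h := by
  funext w
  have h₁ : insW 𝕜 (insW 𝕜 f g) h w = usum 𝕜 w fun u q => usum 𝕜 q fun v₁ v₂ =>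
      extend h (g (letter d f u :: v₁)) v₂ := by
    rw [← usum_coassoc]
    refine usum_congr 𝕜 fun p v₂ _ => ?_
    rw [← hh.multilin.extendLin_apply, insW, map_usum]
    refine usum_congr 𝕜 fun u v₁ _ => ?_
    rw [hh.multilin.extendLin_apply, extend_homog hf.homog hg.multilin]
  rw [Pi.add_apply, h₁, insTwo, ← usum_add]
  refine usum_congr 𝕜 fun u q _ => ?_
  rw [extend_homog hf.homog (hg.ins hh).multilin, insW, usum_cons, ← usum_add]
  refine usum_congr 𝕜 fun v₁ v₂ _ => ?_
  rw [extend_homog hg.homog hh.multilin v₁]; rfl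

lemma insTwo_symm (d e : ℤ) (f g : Word E → ⨁ i, E i) {h : Word E → ⨁ i, E i}
    (hh : SymOn 𝕜 h) :
    insTwo 𝕜 d e f g h = (-1 : 𝕜) ^ (d * e) • insTwo 𝕜 e d g f h := by
  funext w
  rw [Pi.smul_apply, insTwo, insTwo, ← usum_coassoc, ← usum_coassoc, ← usum_smul]
  refine usum_congr 𝕜 fun p v₂ _ => ?_
  rw [usum_cocomm, ← usum_smul]
  refine usum_congr 𝕜 fun u v _ => ?_
  have := hh [] v₂ (letter e g u) (letter d f v)
  simp only [List.nil_append] at this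
  rw [this, smul_smul, smul_smul, smul_smul]
  congr 1
  simp only [letter, mul_add, add_mul, sign_add, mul_comm (wdeg v) (wdeg u), mul_comm e d,
    mul_comm (wdeg u) d]
  linear_combination ((-1 : 𝕜) ^ (wdeg u * wdeg v) * (-1) ^ (e * wdeg v) * (-1) ^ (d * e)) *
    ((-1) ^ (d * wdeg u) * (-1) ^ (d * wdeg u) * sign_mul_self 𝕜 (wdeg u * wdeg v) +
      sign_mul_self 𝕜 (d * wdeg u))

/-- The graded right-symmetry of the associator of the insertion product. -/
lemma insW_associator {d e k : ℤ} {f g h : Word E → ⨁ i, E i} (hf : SVFOn 𝕜 d f)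
    (hg : SVFOn 𝕜 e g) (hh : SVFOn 𝕜 k h) :
    insW 𝕜 f (insW 𝕜 g h) - insW 𝕜 (insW 𝕜 f g) h =
      (-1 : 𝕜) ^ (d * e) • (insW 𝕜 g (insW 𝕜 f h) - insW 𝕜 (insW 𝕜 g f) h) := by
  rw [insW_insW hf hg hh, insW_insW hg hf hh, add_sub_cancel_left, add_sub_cancel_left,
    insTwo_symm d e f g hh.sym]

variable (𝕜) in
/-- The Richardson–Nijenhuis bracket of functions on words. -/
def brW (d e : ℤ) (f g : Word E → ⨁ i, E i) : Word E → ⨁ i, E i :=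
  insW 𝕜 f g - (-1 : 𝕜) ^ (d * e) • insW 𝕜 g f

lemma SVFOn.br {d e : ℤ} {f g : Word E → ⨁ i, E i} (hf : SVFOn 𝕜 d f) (hg : SVFOn 𝕜 e g) :
    SVFOn 𝕜 (d + e) (brW 𝕜 d e f g) := by
  have h := (add_comm e d ▸ hg.ins hf).smul (-(-1 : 𝕜) ^ (d * e))
  rw [neg_smul] at h
  rw [brW, sub_eq_add_neg]
  exact (hf.ins hg).add h

lemma brW_symm (f g : Word E → ⨁ i, E i) : brW 𝕜 1 1 f g = brW 𝕜 1 1 g f := by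
  simp only [brW, mul_one, zpow_one]; module

lemma brW_zero_right {d e : ℤ} {f : Word E → ⨁ i, E i} (hf : MultilinOn 𝕜 f) :
    brW 𝕜 d e f 0 = 0 := by
  have h₁ := insW_smul_right f 0 (0 : 𝕜)
  have h₂ := insW_smul_left (f := 0) hf (0 : 𝕜)
  simp only [zero_smul] at h₁ h₂
  rw [brW, h₁, h₂, smul_zero, sub_zero]

lemma brW_zero_left {d e : ℤ} {f : Word E → ⨁ i, E i} (hf : MultilinOn 𝕜 f) :
    brW 𝕜 d e 0 f = 0 := by
  have h₁ := insW_smul_right f 0 (0 : 𝕜)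
  have h₂ := insW_smul_left (f := 0) hf (0 : 𝕜)
  simp only [zero_smul] at h₁ h₂
  rw [brW, h₁, h₂, smul_zero, sub_zero]

/-- Bracketing with a form of degree `0` is a derivation of the bracket. -/
lemma brW_jacobi {e k : ℤ} {f g h : Word E → ⨁ i, E i} (hf : SVFOn 𝕜 0 f)
    (hg : SVFOn 𝕜 e g) (hh : SVFOn 𝕜 k h) :
    brW 𝕜 0 (e + k) f (brW 𝕜 e k g h) =
      brW 𝕜 e k (brW 𝕜 0 e f g) h + brW 𝕜 e k g (brW 𝕜 0 k f h) := by
  have h₁ := insW_associator hf hg hh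
  have h₂ := insW_associator hf hh hg
  have h₃ := insW_associator hg hh hf
  simp only [brW, zero_mul, zpow_zero, one_smul, sub_eq_add_neg, ← neg_smul,
    ← neg_one_smul 𝕜 (insW 𝕜 _ _ : Word E → ⨁ i, E i), insW_add_right, insW_smul_right,
    insW_add_left hf.multilin, insW_smul_left hf.multilin, insW_add_left hg.multilin,
    insW_smul_left hg.multilin, insW_add_left hh.multilin, insW_smul_left hh.multilin]
    at h₁ h₂ h₃ ⊢
  linear_combination (norm := module) h₁ - (-1 : 𝕜) ^ (e * k) • h₂ + h₃

end Insertion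

section Shuffles

variable {𝕜 : Type} [Field 𝕜]
variable {E : ℤ → Type}
variable {V : Type} [AddCommGroup V] [Module 𝕜 V]

/-- The subword of `y` selected by a mask. -/
def subword {n : ℕ} (y : Fin n → Σ i, E i) (b : Fin n → Bool) : Word E :=
  ((List.finRange n).filter b).map y

lemma sign_wdeg_subword {n : ℕ} (a : ℤ) (y : Fin n → Σ i, E i) (b : Fin n → Bool) :
    (-1 : 𝕜) ^ (a * wdeg (subword y b)) =
      ∏ j, if b j then (-1 : 𝕜) ^ (a * (y j).1) else 1 := by
  rw [Fin.prod_univ_def, subword]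
  generalize List.finRange n = l
  induction l with
  | nil => simp
  | cons i l ih =>
    rw [List.map_cons, List.prod_cons, ← ih]
    by_cases h : b i <;> simp [h, mul_add, sign_add]

lemma subword_cons {n : ℕ} (y : Fin (n + 1) → Σ i, E i) (c : Bool) (b : Fin n → Bool) :
    subword y (Fin.cons c b : Fin (n + 1) → Bool) =
      bif c then y 0 :: subword (fun i => y i.succ) b else subword (fun i => y i.succ) b := by
  have h : ((List.finRange n).map Fin.succ).filter (Fin.cons c b : Fin (n + 1) → Bool) =
      ((List.finRange n).filter b).map Fin.succ := by
    rw [List.filter_map]; congr 1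
  cases c <;> simp [subword, List.finRange_succ, h]

lemma usum_ofFn {n : ℕ} (y : Fin n → Σ i, E i) (Φ : Word E → Word E → V) :
    usum 𝕜 (List.ofFn y) Φ = ∑ b : Fin n → Bool,
      (∏ i, ∏ j, if i < j ∧ b i = false ∧ b j = true then (-1 : 𝕜) ^ ((y i).1 * (y j).1) else 1) •
        Φ (subword y b) (subword y fun i => !b i) := by
  induction n generalizing Φ with
  | zero => simp [subword]
  | succ n ih =>
    have hneg : ∀ (c : Bool) (b : Fin n → Bool),
        (fun i => !(Fin.cons c b : Fin (n + 1) → Bool) i) =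
          (Fin.cons (!c) fun i => !b i : Fin (n + 1) → Bool) := fun c b => by
      funext i; cases i using Fin.cases <;> rfl
    rw [List.ofFn_succ, usum_cons, ih, ← (Fin.consEquiv fun _ => Bool).sum_comp,
      Fintype.sum_prod_type, Fintype.sum_bool, ← Finset.sum_add_distrib]
    refine Finset.sum_congr rfl fun b _ => ?_
    simp only [Fin.consEquiv, Equiv.coe_fn_mk, hneg, subword_cons, Fin.prod_univ_succ,
      Fin.cons_zero, Fin.cons_succ, sign_wdeg_subword, smul_add, smul_smul]
    simp [mul_comm]

lemma sortedLT_finRange_filter {n : ℕ} (b : Fin n → Bool) :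
    ((List.finRange n).filter b).Pairwise (· < ·) :=
  (List.pairwise_lt_finRange n).filter _

lemma eq_filter_finRange {n : ℕ} {l : List (Fin n)} {b : Fin n → Bool}
    (hl : l.Pairwise (· < ·)) (h : ∀ i, i ∈ l ↔ b i = true) :
    l = (List.finRange n).filter b := by
  refine List.Perm.eq_of_pairwise (fun a c _ _ h₁ h₂ => absurd h₂ h₁.asymm) hl
    (sortedLT_finRange_filter b) ?_
  rw [List.perm_ext_iff_of_nodup hl.nodup (sortedLT_finRange_filter b).nodup]
  simp [h]

/-- The mask of the first `k` values of a permutation. -/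
def headMask {n : ℕ} (k : ℕ) (σ : Equiv.Perm (Fin n)) : Fin n → Bool :=
  fun i => decide ((σ.symm i : ℕ) < k)

lemma ofFn_head_eq {n k : ℕ} (hk : k ≤ n) {σ : Equiv.Perm (Fin n)} (hσ : IsShuffle k σ) :
    List.ofFn (fun i : Fin k => σ ⟨i, i.isLt.trans_le hk⟩) =
      (List.finRange n).filter (headMask k σ) := by
  refine eq_filter_finRange ?_ fun i => ?_
  · rw [List.pairwise_ofFn]
    exact fun i j hij => hσ _ _ hij (Or.inl j.isLt)
  · simp only [List.mem_ofFn, headMask, decide_eq_true_eq]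
    constructor
    · rintro ⟨j, rfl⟩; simp
    · exact fun h => ⟨⟨_, h⟩, by simp⟩

lemma ofFn_tail_eq {n k : ℕ} (hk : k ≤ n) {σ : Equiv.Perm (Fin n)} (hσ : IsShuffle k σ) :
    List.ofFn (fun i : Fin (n - k) => σ ⟨k + i, by omega⟩) =
      (List.finRange n).filter fun i => !headMask k σ i := by
  refine eq_filter_finRange ?_ fun i => ?_
  · rw [List.pairwise_ofFn]
    exact fun i j hij => hσ _ _ (by simpa using hij) (Or.inr (by simp))
  · simp only [List.mem_ofFn, headMask, Bool.not_eq_true', decide_eq_false_iff_not]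
    constructor
    · rintro ⟨j, rfl⟩; simp
    · exact fun h => ⟨⟨(σ.symm i : ℕ) - k, by omega⟩, by simp [Nat.add_sub_cancel' (not_lt.1 h)]⟩

lemma koszulSign_eq {n k : ℕ} [CharZero 𝕜] (ι : Fin n → ℤ) {σ : Equiv.Perm (Fin n)}
    (hσ : IsShuffle k σ) :
    koszulSign 𝕜 ι σ = ∏ i, ∏ j,
      if i < j ∧ headMask k σ i = false ∧ headMask k σ j = true then (-1 : 𝕜) ^ (ι i * ι j)
      else 1 := by
  rw [← Fintype.prod_prod_type', koszulSign, Finset.prod_filter]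
  refine Fintype.prod_equiv ((Equiv.prodComm _ _).trans (Equiv.prodCongr σ σ)) _ _ ?_
  rintro ⟨i, j⟩
  simp only [headMask, Equiv.trans_apply, Equiv.prodComm_apply, Prod.swap_prod_mk,
    Equiv.prodCongr_apply, Prod.map_apply, Equiv.symm_apply_apply, decide_eq_false_iff_not,
    decide_eq_true_eq, mul_comm (ι (σ j))]
  refine if_congr ⟨fun h => ⟨h.2, ?_⟩, fun h => ⟨?_, h.1⟩⟩ rfl rfl
  · have : ¬((j : ℕ) < k ∨ k ≤ (i : ℕ)) := fun h' => (hσ i j h.1 h').asymm h.2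
    omega
  · rw [Fin.lt_def]; omega

/-- Every mask is the mask of the first values of a shuffle. -/
lemma exists_shuffle {n : ℕ} (b : Fin n → Bool) :
    ∃ k ≤ n, ∃ σ : Equiv.Perm (Fin n), IsShuffle k σ ∧ headMask k σ = b := by
  let u := (List.finRange n).filter b
  let v := (List.finRange n).filter fun i => !b i
  have hperm : (u ++ v).Perm (List.finRange n) := List.filter_append_perm _ _
  have hlen : (u ++ v).length = n := by rw [hperm.length_eq, List.length_finRange]
  have hnd : (u ++ v).Nodup := hperm.nodup_iff.2 (List.nodup_finRange n)
  have hinj : Function.Injective fun i : Fin n => (u ++ v)[(i : ℕ)]'(by omega) := fun i j h =>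
    Fin.ext ((hnd.getElem_inj_iff).1 h)
  let σ : Equiv.Perm (Fin n) := Equiv.ofBijective _ (Finite.injective_iff_bijective.1 hinj)
  have hσ : ∀ i : Fin n, σ i = (u ++ v)[(i : ℕ)]'(by omega) := fun _ => rfl
  have hlen' : u.length + v.length = n := by rw [← List.length_append, hlen]
  refine ⟨u.length, by omega, σ, fun i j hij h => ?_, funext fun i => ?_⟩
  · rw [hσ, hσ]
    rcases h with h | h
    · rw [List.getElem_append_left (by omega), List.getElem_append_left h]
      exact List.pairwise_iff_getElem.1 (sortedLT_finRange_filter b) _ _ _ _ hij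
    · rw [List.getElem_append_right h, List.getElem_append_right (by omega)]
      exact List.pairwise_iff_getElem.1 (sortedLT_finRange_filter _) _ _ _ _ (by omega)
  · obtain ⟨j, rfl⟩ := σ.surjective i
    rw [headMask, Equiv.symm_apply_apply, hσ]
    by_cases h : (j : ℕ) < u.length
    · have := (List.mem_filter.1 (List.getElem_mem h)).2
      rw [List.getElem_append_left h, decide_eq_true h, ← this]
    · have h' : (j : ℕ) - u.length < v.length := by omega
      have := (List.mem_filter.1 (List.getElem_mem h')).2
      rw [Bool.not_eq_true'] at this
      rw [List.getElem_append_right (not_lt.1 h), decide_eq_false h, ← this]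

lemma headMask_injective {n k l : ℕ} (hk : k ≤ n) (hl : l ≤ n) {σ τ : Equiv.Perm (Fin n)}
    (hσ : IsShuffle k σ) (hτ : IsShuffle l τ) (h : headMask k σ = headMask l τ) :
    k = l ∧ σ = τ := by
  have h₁ := (ofFn_head_eq hk hσ).trans (h ▸ (ofFn_head_eq hl hτ).symm)
  have h₂ := (ofFn_tail_eq hk hσ).trans (h ▸ (ofFn_tail_eq hl hτ).symm)
  obtain rfl : k = l := by simpa using congrArg List.length h₁
  rw [List.ofFn_inj] at h₁ h₂
  refine ⟨rfl, Equiv.ext fun i => ?_⟩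
  by_cases hi : (i : ℕ) < k
  · exact congrFun h₁ ⟨i, hi⟩
  · have := congrFun h₂ ⟨i - k, by omega⟩
    simpa [Nat.add_sub_cancel' (not_lt.1 hi)] using this

lemma sum_shuffles [CharZero 𝕜] {n : ℕ} (y : Fin n → Σ i, E i) (Φ : Word E → Word E → V) :
    (∑ k : Fin (n + 1), ∑ σ ∈ Finset.univ.filter (fun σ : Equiv.Perm (Fin n) => IsShuffle k σ),
      koszulSign 𝕜 (fun i => (y i).1) σ •
        Φ (List.ofFn fun i : Fin k => y (σ ⟨i, by have := i.isLt; have := k.isLt; omega⟩))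
          (List.ofFn fun i : Fin (n - k) =>
            y (σ ⟨k + i, by have := i.isLt; have := k.isLt; omega⟩))) =
      usum 𝕜 (List.ofFn y) Φ := by
  rw [usum_ofFn, Finset.sum_sigma']
  refine Finset.sum_bij (fun p _ => headMask p.1 p.2) (fun _ _ => Finset.mem_univ _) ?_ ?_ ?_
  · rintro ⟨k, σ⟩ hσ ⟨l, τ⟩ hτ h
    simp only [Finset.mem_sigma, Finset.mem_filter, Finset.mem_univ, true_and] at hσ hτ
    obtain ⟨h₁, rfl⟩ := headMask_injective (by omega) (by omega) hσ hτ h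
    obtain rfl := Fin.ext h₁
    rfl
  · intro b _
    obtain ⟨k, hk, σ, hσ, rfl⟩ := exists_shuffle b
    exact ⟨⟨⟨k, by omega⟩, σ⟩, by simpa using hσ, rfl⟩
  · rintro ⟨k, σ⟩ hσ
    simp only [Finset.mem_sigma, Finset.mem_filter, Finset.mem_univ, true_and] at hσ
    rw [koszulSign_eq _ hσ, subword, subword, ← ofFn_head_eq (by omega) hσ,
      ← ofFn_tail_eq (by omega) hσ, List.map_ofFn, List.map_ofFn]
    rfl

end Shuffles

section Bridge

variable (𝕜 : Type) [Field 𝕜]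
variable {E : ℤ → Type}

lemma exists_ofFn (w : Word E) : ∃ (n : ℕ) (y : Fin n → Σ i, E i), w = List.ofFn y :=
  ⟨_, _, (List.equivSigmaTuple.symm_apply_apply w).symm⟩

variable [∀ i, AddCommGroup (E i)] [∀ i, Module 𝕜 (E i)]

/-- A raw form, as a function on words. -/
def toW (F : RawForm E) (w : Word E) : ⨁ i, E i :=
  F _ (fun j => ((List.equivSigmaTuple w).2 j).1) fun j => ((List.equivSigmaTuple w).2 j).2

lemma toW_ofFn (F : RawForm E) {n : ℕ} (y : Fin n → Σ i, E i) :
    toW F (List.ofFn y) = F n (fun j => (y j).1) fun j => (y j).2 := by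
  have h : List.equivSigmaTuple (List.ofFn y) = ⟨n, y⟩ :=
    List.equivSigmaTuple.apply_symm_apply ⟨n, y⟩
  rw [toW, h]

lemma toW_injective : Function.Injective (toW : RawForm E → Word E → ⨁ i, E i) := by
  intro F G h
  funext n ι x
  have := congrFun h (List.ofFn fun j => ⟨ι j, x j⟩)
  rwa [toW_ofFn, toW_ofFn] at this

lemma toW_cons (F : RawForm E) {n : ℕ} (m : ℤ) (e : E m) (y : Fin n → Σ i, E i) :
    toW F (⟨m, e⟩ :: List.ofFn y) =
      F (n + 1) (dcons m fun j => (y j).1) (dconsV E e fun j => (y j).2) := by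
  have h : (⟨m, e⟩ :: List.ofFn y : Word E) = List.ofFn fun j : Fin (n + 1) =>
      (⟨dcons m (fun j => (y j).1) j, dconsV E e (fun j => (y j).2) j⟩ : Σ i, E i) := by
    rw [List.ofFn_succ]; rfl
  rw [h, toW_ofFn]

lemma toW_ins [CharZero 𝕜] (F G : RawForm E) : toW (ins 𝕜 E F G) = insW 𝕜 (toW F) (toW G) := by
  funext w
  obtain ⟨n, y, rfl⟩ := exists_ofFn w
  rw [toW_ofFn, insW, ← sum_shuffles, ins]
  simp only [extend, toW_cons, toW_ofFn]

lemma toW_rnb [CharZero 𝕜] (d e : ℤ) (F G : RawForm E) :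
    toW (rnb 𝕜 E d e F G) = brW 𝕜 d e (toW F) (toW G) := by
  rw [brW, ← toW_ins, ← toW_ins]; rfl

variable {𝕜}

lemma IsMultilin.multilinOn {F : RawForm E} (hF : IsMultilin 𝕜 E F) :
    MultilinOn 𝕜 (toW F) := by
  have hset : ∀ (p q : Word E) (x : Σ i, E i), ∃ (n : ℕ) (y : Fin n → Σ i, E i) (j : Fin n),
      y j = x ∧ ∀ z, p ++ z :: q = List.ofFn (Function.update y j z) := by
    intro p q x
    refine ⟨_, (p ++ x :: q).get, ⟨p.length, by simp⟩, by simp, fun z => ?_⟩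
    refine List.ext_getElem (by simp; omega) fun k h₁ h₂ => ?_
    rw [List.getElem_ofFn, Function.update_apply]
    split_ifs with h
    · obtain rfl : k = p.length := congrArg Fin.val h
      simp
    · have hk : k ≠ p.length := fun h' => h (Fin.ext h')
      simp only [List.get_eq_getElem, List.getElem_append, List.getElem_cons]
      split_ifs <;> first | rfl | omega
  have hupd : ∀ {n : ℕ} (y : Fin n → Σ i, E i) (j : Fin n) (a : E (y j).1),
      toW F (List.ofFn (Function.update y j ⟨(y j).1, a⟩)) =
        F n (fun k => (y k).1) (Function.update (fun k => (y k).2) j a) := by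
    intro n y j a
    have : Function.update y j ⟨(y j).1, a⟩ =
        fun k => ⟨(y k).1, Function.update (fun k => (y k).2) j a k⟩ := by
      funext k
      by_cases h : k = j
      · subst h; simp
      · simp [h]
    rw [this, toW_ofFn]
  constructor
  · intro p q i a b
    obtain ⟨n, y, j, hj, h⟩ := hset p q ⟨i, a⟩
    obtain rfl : (y j).1 = i := by rw [hj]
    simp only [h, hupd]
    exact (hF n (fun k => (y k).1) (fun k => (y k).2) j a b 1).1
  · intro p q i c a
    obtain ⟨n, y, j, hj, h⟩ := hset p q ⟨i, a⟩
    obtain rfl : (y j).1 = i := by rw [hj]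
    simp only [h, hupd]
    exact (hF n (fun k => (y k).1) (fun k => (y k).2) j a a c).2

lemma IsGradedSym.symOn {F : RawForm E} (hF : IsGradedSym 𝕜 E F) : SymOn 𝕜 (toW F) := by
  intro p q x y
  set s := (p ++ y :: x :: q).get with hs
  let i : Fin (p ++ y :: x :: q).length := ⟨p.length, by simp⟩
  let j : Fin (p ++ y :: x :: q).length := ⟨p.length + 1, by simp⟩
  have h₁ : p ++ y :: x :: q = List.ofFn s := (List.ofFn_get _).symm
  have h₂ : p ++ x :: y :: q = List.ofFn fun k => s (Equiv.swap i j k) := by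
    refine List.ext_getElem (by simp; omega) fun k hk₁ hk₂ => ?_
    rw [List.getElem_ofFn, Equiv.swap_apply_def]
    simp only [i, j, Fin.mk.injEq]
    split_ifs with h h'
    · subst h; simp [hs]
    · subst h'; simp [hs]
    · simp only [hs, List.get_eq_getElem, List.getElem_append, List.getElem_cons]
      split_ifs <;> first | rfl | omega
  have hi : s i = y := by simp [hs, i]
  have hj : s j = x := by simp [hs, j]
  rw [h₁, h₂, toW_ofFn, toW_ofFn]
  have := hF _ (fun k => (s k).1) (fun k => (s k).2) i j rfl
  rwa [hi, hj, mul_comm] at this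

lemma IsOfDeg.homogOn {d : ℤ} {F : RawForm E} (hF : IsOfDeg E d F) : HomogOn d (toW F) := by
  intro w m hm
  obtain ⟨n, y, rfl⟩ := exists_ofFn w
  rw [toW_ofFn]
  refine hF n _ _ m fun h => hm ?_
  rw [h]
  clear * -
  induction n with
  | zero => simp
  | succ n ih => rw [Fin.sum_univ_succ, List.ofFn_succ, wdeg_cons, add_assoc, ih, add_assoc]

lemma IsSVF.svfOn {d : ℤ} {F : RawForm E} (hF : IsSVF 𝕜 E d F) : SVFOn 𝕜 d (toW F) :=
  ⟨hF.1.multilinOn, hF.2.1.symOn, hF.2.2.homogOn⟩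

end Bridge

section Nijenhuis

variable {𝕜 : Type} [Field 𝕜]
variable {E : ℤ → Type} [∀ i, AddCommGroup (E i)] [∀ i, Module 𝕜 (E i)]

/-- The iterated deformation, for functions on words. -/
def deformW (𝕜 : Type) [Field 𝕜] {E : ℤ → Type} [∀ i, AddCommGroup (E i)]
    [∀ i, Module 𝕜 (E i)] (N μ : Word E → ⨁ i, E i) : ℕ → Word E → ⨁ i, E i
  | 0 => μ
  | k + 1 => brW 𝕜 0 1 N (deformW 𝕜 N μ k)

lemma toW_deform [CharZero 𝕜] (N μ : RawForm E) (k : ℕ) :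
    toW (deform 𝕜 E N μ k) = deformW 𝕜 (toW N) (toW μ) k := by
  induction k with
  | zero => rfl
  | succ k ih => rw [deform, toW_rnb, ih, deformW]

lemma SVFOn.deform {N μ : Word E → ⨁ i, E i} (hN : SVFOn 𝕜 0 N) (hμ : SVFOn 𝕜 1 μ) (k : ℕ) :
    SVFOn 𝕜 1 (deformW 𝕜 N μ k) := by
  induction k with
  | zero => exact hμ
  | succ k ih => exact zero_add (1 : ℤ) ▸ hN.br ih

lemma deformW_square {N K μ : Word E → ⨁ i, E i} (hN : SVFOn 𝕜 0 N) (hK : SVFOn 𝕜 0 K)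
    (hμ : SVFOn 𝕜 1 μ) (hsq : brW 𝕜 0 1 N (brW 𝕜 0 1 N μ) = brW 𝕜 0 1 K μ)
    (hcom : brW 𝕜 0 0 N K = 0) (k : ℕ) :
    deformW 𝕜 N μ (k + 2) = brW 𝕜 0 1 K (deformW 𝕜 N μ k) := by
  induction k with
  | zero => exact hsq
  | succ k ih =>
    have hk := hN.deform hμ k
    have hj := brW_jacobi hN hK hk
    rw [zero_add, hcom, brW_zero_left hk.multilin, zero_add] at hj
    rw [deformW, ih, hj, deformW]

lemma brW_deformW_eq_zero [CharZero 𝕜] {N K μ : Word E → ⨁ i, E i} (hN : SVFOn 𝕜 0 N)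
    (hK : SVFOn 𝕜 0 K) (hμ : SVFOn 𝕜 1 μ) (hμμ : brW 𝕜 1 1 μ μ = 0)
    (hsq : brW 𝕜 0 1 N (brW 𝕜 0 1 N μ) = brW 𝕜 0 1 K μ) (hcom : brW 𝕜 0 0 N K = 0)
    (k l : ℕ) : brW 𝕜 1 1 (deformW 𝕜 N μ k) (deformW 𝕜 N μ l) = 0 := by
  have hdef := hN.deform hμ
  set c := fun k l => brW 𝕜 1 1 (deformW 𝕜 N μ k) (deformW 𝕜 N μ l) with hc
  have hsymm : ∀ k l, c k l = c l k := fun _ _ => brW_symm _ _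
  have hone : ∀ k l, c k l = 0 → c (k + 1) l + c k (l + 1) = 0 := fun k l h => by
    have hj := brW_jacobi hN (hdef k) (hdef l)
    rw [show brW 𝕜 1 1 _ _ = c k l from rfl, h, brW_zero_right hN.multilin] at hj
    exact hj.symm
  have htwo : ∀ k l, c k l = 0 → c (k + 2) l + c k (l + 2) = 0 := fun k l h => by
    have hj := brW_jacobi hK (hdef k) (hdef l)
    rw [show brW 𝕜 1 1 _ _ = c k l from rfl, h, brW_zero_right hK.multilin] at hj
    simp only [hc, deformW_square hN hK hμ hsq hcom]
    exact hj.symm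
  have hself : ∀ f : Word E → ⨁ i, E i, f + f = 0 → f = 0 := fun f hf => by
    rw [← two_smul 𝕜] at hf
    exact (smul_eq_zero.1 hf).resolve_left two_ne_zero
  have key : ∀ m k l, k + l = m → c k l = 0 := by
    intro m
    induction m using Nat.strong_induction_on with
    | _ m ih =>
      have h₀ : c 0 m = 0 := by
        match m with
        | 0 => exact hμμ
        | 1 =>
          have := hone 0 0 hμμ
          rw [hsymm] at this
          exact hself _ this
        | m + 2 =>
          have e₁ := hone 0 (m + 1) (ih (m + 1) (by omega) _ _ (by omega))
          have e₂ := hone 1 m (ih (m + 1) (by omega) _ _ (by omega))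
          have e₃ := htwo 0 m (ih m (by omega) _ _ (by omega))
          refine hself _ ?_
          linear_combination (norm := module) e₁ + e₃ - e₂
      intro k
      induction k with
      | zero =>
        intro l h
        obtain rfl : l = m := by omega
        exact h₀
      | succ k ihk =>
        intro l h
        have := hone k l (ih (k + l) (by omega) k l rfl)
        rwa [ihk (l + 1) (by omega), add_zero] at this
  exact key _ k l rfl

end Nijenhuis

/-- If `𝒩` is Nijenhuis with respect to a (curved) `L∞`-structure `μ`
with square `𝒦`, then (1) for every `k ≥ 1` the deformation `μ_k` is a (curved)
`L∞`-structure and `𝒩` is Nijenhuis with respect to `μ_k` with the same square `𝒦`;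
(2) `[μ_k,μ_l]_RN = 0` for all `k, l ≥ 1`. -/
theorem statement8 (𝕜 : Type) [Field 𝕜] [CharZero 𝕜]
    (E : ℤ → Type) [∀ i, AddCommGroup (E i)] [∀ i, Module 𝕜 (E i)]
    (μ N K : RawForm E)
    (hμ : IsSVF 𝕜 E 1 μ) (hμμ : rnb 𝕜 E 1 1 μ μ = 0)
    (hN : IsSVF 𝕜 E 0 N) (hK : IsSVF 𝕜 E 0 K)
    (hsq : rnb 𝕜 E 0 1 N (rnb 𝕜 E 0 1 N μ) = rnb 𝕜 E 0 1 K μ)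
    (hcom : rnb 𝕜 E 0 0 N K = 0) :
    (∀ k : ℕ, 1 ≤ k →
        rnb 𝕜 E 1 1 (deform 𝕜 E N μ k) (deform 𝕜 E N μ k) = 0 ∧
          rnb 𝕜 E 0 1 N (rnb 𝕜 E 0 1 N (deform 𝕜 E N μ k)) =
            rnb 𝕜 E 0 1 K (deform 𝕜 E N μ k)) ∧
      ∀ k l : ℕ, 1 ≤ k → 1 ≤ l →
        rnb 𝕜 E 1 1 (deform 𝕜 E N μ k) (deform 𝕜 E N μ l) = 0 := by
  have hcurv : ∀ k l, rnb 𝕜 E 1 1 (deform 𝕜 E N μ k) (deform 𝕜 E N μ l) = 0 := fun k l => by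
    refine toW_injective ?_
    rw [toW_rnb, toW_deform, toW_deform]
    exact brW_deformW_eq_zero hN.svfOn hK.svfOn hμ.svfOn (by rw [← toW_rnb, hμμ]; rfl)
      (by simp only [← toW_rnb, hsq]) (by rw [← toW_rnb, hcom]; rfl) k l
  refine ⟨fun k _ => ⟨hcurv k k, toW_injective ?_⟩, fun k l _ _ => hcurv k l⟩
  rw [toW_rnb, toW_rnb, toW_rnb, toW_deform]
  exact deformW_square hN.svfOn hK.svfOn hμ.svfOn (by simp only [← toW_rnb, hsq])
    (by rw [← toW_rnb, hcom]; rfl) k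

end RN
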